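/- Let φ(x) = (2π)^(−1/2) exp(−x²/2) denote the standard normal density and Φ(x) = ∫_{−∞}^x φ(t) dt the standard normal CDF. For all real numbers α < β, with w := Φ(β) − Φ(α) > 0, one has w · ∫_α^β t² φ(t) dt − (φ(α) − φ(β))² ≤ w². Equivalently, the variance of the standard normal distribution truncated to [α, β] is at most 1. -/

import Mathlib

open MeasureTheory

/-- The standard normal density `φ(x) = (2π)^(−1/2) exp(−x²/2)`. -/
noncomputable def stdNormalPDF (x : ℝ) : ℝ :=
  (Real.sqrt (2 * Real.pi))⁻¹ * Real.exp (-x ^ 2 / 2)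

/-- The standard normal CDF `Φ(x) = ∫_{−∞}^x φ(t) dt`. -/
noncomputable def stdNormalCDF (x : ℝ) : ℝ :=
  ∫ t in Set.Iic x, stdNormalPDF t

theorem continuous_stdNormalPDF : Continuous stdNormalPDF := by
  unfold stdNormalPDF
  fun_prop

theorem stdNormalPDF_nonneg (x : ℝ) : 0 ≤ stdNormalPDF x := by
  unfold stdNormalPDF
  positivity

theorem integrable_stdNormalPDF : Integrable stdNormalPDF := by
  refine ((integrable_exp_neg_mul_sq (b := 1 / 2) (by norm_num)).const_mul
    (Real.sqrt (2 * Real.pi))⁻¹).congr (ae_of_all _ fun x => ?_)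
  simp only [stdNormalPDF]
  ring_nf

theorem hasDerivAt_stdNormalPDF (x : ℝ) : HasDerivAt stdNormalPDF (-x * stdNormalPDF x) x := by
  have h : HasDerivAt (fun y : ℝ => -y ^ 2 / 2) (-x) x :=
    ((hasDerivAt_pow 2 x).fun_neg.div_const 2).congr_deriv (by norm_num; ring)
  refine (h.exp.const_mul (Real.sqrt (2 * Real.pi))⁻¹).congr_deriv ?_
  simp only [stdNormalPDF]
  ring

theorem stdNormalCDF_sub_stdNormalCDF (a b : ℝ) :
    stdNormalCDF b - stdNormalCDF a = ∫ t in a..b, stdNormalPDF t :=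
  intervalIntegral.integral_Iic_sub_Iic integrable_stdNormalPDF.integrableOn
    integrable_stdNormalPDF.integrableOn

theorem integral_mul_stdNormalPDF (a b : ℝ) :
    ∫ t in a..b, t * stdNormalPDF t = stdNormalPDF a - stdNormalPDF b := by
  rw [intervalIntegral.integral_eq_sub_of_hasDerivAt (f := fun x => -stdNormalPDF x)]
  · ring
  · intro x _
    simpa using (hasDerivAt_stdNormalPDF x).fun_neg
  · exact (continuous_id.mul continuous_stdNormalPDF).intervalIntegrable a b

theorem integral_sq_mul_stdNormalPDF (a b : ℝ) :
    ∫ t in a..b, t ^ 2 * stdNormalPDF t =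
      (∫ t in a..b, stdNormalPDF t) + (a * stdNormalPDF a - b * stdNormalPDF b) := by
  have hφ := continuous_stdNormalPDF
  have hsq : Continuous fun t : ℝ => t ^ 2 * stdNormalPDF t := by fun_prop
  have h : ∫ t in a..b, (t ^ 2 * stdNormalPDF t - stdNormalPDF t) =
      a * stdNormalPDF a - b * stdNormalPDF b := by
    rw [intervalIntegral.integral_eq_sub_of_hasDerivAt (f := fun x => -(x * stdNormalPDF x))]
    · ring
    · intro x _
      refine ((hasDerivAt_id' x).fun_mul (hasDerivAt_stdNormalPDF x)).fun_neg.congr_deriv ?_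
      ring
    · exact (hsq.sub hφ).intervalIntegrable a b
  rw [intervalIntegral.integral_sub (hsq.intervalIntegrable a b) (hφ.intervalIntegrable a b)] at h
  linarith

/-- With `w := Φ(β) − Φ(α)`, for `α < β` one has
`w ∫_α^β t² φ(t) dt − (φ(α) − φ(β))² ≤ w²`; equivalently, the variance of the
standard normal truncated to `[α, β]` is at most `1`. -/
theorem stdNormal_truncated_variance_le_one (α β : ℝ) (hαβ : α < β) :
    (stdNormalCDF β - stdNormalCDF α) * (∫ t in Set.Icc α β, t ^ 2 * stdNormalPDF t)
        - (stdNormalPDF α - stdNormalPDF β) ^ 2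
      ≤ (stdNormalCDF β - stdNormalCDF α) ^ 2 := by
  have hφ := continuous_stdNormalPDF
  have hlower : α * (∫ t in α..β, stdNormalPDF t) ≤ stdNormalPDF α - stdNormalPDF β := by
    rw [← integral_mul_stdNormalPDF, ← intervalIntegral.integral_const_mul]
    exact intervalIntegral.integral_mono_on hαβ.le
      ((hφ.const_mul α).intervalIntegrable _ _) ((continuous_id.mul hφ).intervalIntegrable _ _)
      fun t ht => mul_le_mul_of_nonneg_right ht.1 (stdNormalPDF_nonneg t)
  have hupper : stdNormalPDF α - stdNormalPDF β ≤ β * (∫ t in α..β, stdNormalPDF t) := by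
    rw [← integral_mul_stdNormalPDF, ← intervalIntegral.integral_const_mul]
    exact intervalIntegral.integral_mono_on hαβ.le
      ((continuous_id.mul hφ).intervalIntegrable _ _) ((hφ.const_mul β).intervalIntegrable _ _)
      fun t ht => mul_le_mul_of_nonneg_right ht.2 (stdNormalPDF_nonneg t)
  rw [stdNormalCDF_sub_stdNormalCDF, integral_Icc_eq_integral_Ioc,
    ← intervalIntegral.integral_of_le hαβ.le, integral_sq_mul_stdNormalPDF]
  linarith [mul_le_mul_of_nonneg_right hlower (stdNormalPDF_nonneg α),
    mul_le_mul_of_nonneg_right hupper (stdNormalPDF_nonneg β)]
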